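/- Fix E < 0, let d be a positive integer, and define u : ℤ^d → ℝ by u(x) = (2π)^{−d} ∫_{[−π,π]^d} (4 Σ_{j=1}^d sin²(ξ_j/2) + |E|)^{−1} e^{−i⟨x,ξ⟩} dξ. Then: (i) u ∈ ℓ²(ℤ^d); (ii) (H₀ u)(x) + |E| u(x) = δ₀(x) for all x ∈ ℤ^d, where δ₀(x) = 1 if x = 0 and 0 otherwise; (iii) u(0) > 0; and (iv) with the potential V(x) = −u(0)^{−1} δ₀(x), the discrete Schrödinger operator H = H₀ + V satisfies Hu = Eu, i.e., u is an ℓ² eigenfunction of H with eigenvalue E. -/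

import Mathlib

open MeasureTheory Real

noncomputable section

/-- The fundamental solution
`u(x) = (2π)^{−d} ∫_{[−π,π]^d} (4 Σ_j sin²(ξ_j/2) + |E|)^{−1} e^{−i⟨x,ξ⟩} dξ`
(a real number; the integral is real by symmetry). -/
def ufun (d : ℕ) (E : ℝ) (x : Fin d → ℤ) : ℝ :=
  (((2 * π) ^ d)⁻¹ *
    ∫ ξ in Set.univ.pi (fun _ : Fin d => Set.Icc (-π) π),
      (((4 * ∑ j, Real.sin (ξ j / 2) ^ 2 + |E|)⁻¹ : ℝ) : ℂ) *
        Complex.exp (-Complex.I * ((∑ j, (x j : ℝ) * ξ j : ℝ) : ℂ))).re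

/-- The free discrete Schrödinger operator `H₀` on `ℤ^d`:
`(H₀u)(x) = −Σ_{|x−y|=1}(u(y)−u(x))`. -/
def H0 {d : ℕ} (u : (Fin d → ℤ) → ℝ) (x : Fin d → ℤ) : ℝ :=
  -(∑ j : Fin d, ((u (x + Pi.single j 1) - u x) + (u (x - Pi.single j 1) - u x)))

def cubeMeas (d : ℕ) : Measure (Fin d → ℝ) :=
  volume.restrict (Set.univ.pi (fun _ : Fin d => Set.Icc (-π) π))

def ech {d : ℕ} (x : Fin d → ℤ) (ξ : Fin d → ℝ) : ℂ :=
  Complex.exp (-Complex.I * ((∑ j, (x j : ℝ) * ξ j : ℝ) : ℂ))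

def gsym (d : ℕ) (E : ℝ) (ξ : Fin d → ℝ) : ℝ :=
  4 * ∑ j, Real.sin (ξ j / 2) ^ 2 + |E|

def Ucx (d : ℕ) (E : ℝ) (x : Fin d → ℤ) : ℂ :=
  ∫ ξ, (((gsym d E ξ)⁻¹ : ℝ) : ℂ) * ech x ξ ∂(cubeMeas d)

lemma ufun_eq (d : ℕ) (E : ℝ) (x : Fin d → ℤ) :
    ufun d E x = ((2 * π) ^ d)⁻¹ * (Ucx d E x).re := by
  have h : ufun d E x = ((((2 * π) ^ d)⁻¹ : ℝ) * Ucx d E x : ℂ).re := by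
    unfold ufun Ucx gsym ech cubeMeas
    push_cast
    rfl
  rw [h, Complex.re_ofReal_mul]

lemma gsym_pos (d : ℕ) {E : ℝ} (hE : E < 0) (ξ : Fin d → ℝ) : 0 < gsym d E ξ := by
  unfold gsym
  have : 0 < |E| := abs_pos.mpr hE.ne
  have h2 : 0 ≤ ∑ j, Real.sin (ξ j / 2) ^ 2 := Finset.sum_nonneg fun _ _ => sq_nonneg _
  linarith

lemma gsym_cont (d : ℕ) (E : ℝ) : Continuous (gsym d E) := by
  unfold gsym; fun_prop

lemma ech_cont {d : ℕ} (x : Fin d → ℤ) : Continuous (ech x) := by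
  unfold ech; fun_prop

lemma ech_add {d : ℕ} (x y : Fin d → ℤ) (ξ : Fin d → ℝ) : ech (x + y) ξ = ech x ξ * ech y ξ := by
  unfold ech
  rw [← Complex.exp_add, ← mul_add, ← Complex.ofReal_add, ← Finset.sum_add_distrib]
  congr 4
  ext j
  simp [add_mul]

lemma ech_zero {d : ℕ} (ξ : Fin d → ℝ) : ech (0 : Fin d → ℤ) ξ = 1 := by simp [ech]

lemma ech_neg {d : ℕ} (x : Fin d → ℤ) (ξ : Fin d → ℝ) :
    ech (-x) ξ = (starRingEnd ℂ) (ech x ξ) := by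
  unfold ech
  rw [← Complex.exp_conj]
  congr 1
  rw [map_mul, Complex.conj_ofReal]
  simp

lemma ech_single {d : ℕ} (j : Fin d) (ξ : Fin d → ℝ) :
    ech (Pi.single j 1) ξ = Complex.exp (-Complex.I * (ξ j : ℂ)) := by
  unfold ech
  congr 3
  rw [Finset.sum_eq_single j]
  · simp
  · intro b _ hb; simp [hb]
  · simp

lemma ech_lap {d : ℕ} (x : Fin d → ℤ) (j : Fin d) (ξ : Fin d → ℝ) :
    (ech (x + Pi.single j 1) ξ - ech x ξ) + (ech (x - Pi.single j 1) ξ - ech x ξ)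
      = -((4 * Real.sin (ξ j / 2) ^ 2 : ℝ) : ℂ) * ech x ξ := by
  rw [sub_eq_add_neg x, ech_add, ech_add, ech_neg, ech_single, ← Complex.exp_conj]
  have h1 : (4 * Real.sin (ξ j / 2) ^ 2 : ℝ) = 2 - 2 * Real.cos (ξ j) := by
    have : Real.cos (ξ j) = Real.cos (2 * (ξ j / 2)) := by congr 1; ring
    rw [this, Real.cos_two_mul, Real.sin_sq]; ring
  have h2 : (starRingEnd ℂ) (-Complex.I * (ξ j : ℂ)) = (ξ j : ℂ) * Complex.I := by
    rw [map_mul, Complex.conj_ofReal]; simp; ring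
  have h3 : -Complex.I * (ξ j : ℂ) = -(ξ j : ℂ) * Complex.I := by ring
  have h4 := Complex.two_cos (ξ j : ℂ)
  rw [h2, h3, h1]
  push_cast
  rw [h4]
  ring

instance (d : ℕ) : IsFiniteMeasure (cubeMeas d) := by
  constructor
  unfold cubeMeas
  rw [Measure.restrict_apply_univ]
  exact (isCompact_univ_pi fun _ => isCompact_Icc).measure_lt_top

lemma cont_int {d : ℕ} {f : (Fin d → ℝ) → ℂ} (hf : Continuous f) : Integrable f (cubeMeas d) :=
  hf.continuousOn.integrableOn_compact (isCompact_univ_pi fun _ => isCompact_Icc)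

lemma int_one (n : ℤ) : ∫ t in Set.Icc (-π) π, Complex.exp (-Complex.I * ((n : ℝ) * t : ℝ))
    = if n = 0 then ((2 * π : ℝ) : ℂ) else 0 := by
  have hpi : -π ≤ π := by linarith [Real.pi_pos]
  rw [integral_Icc_eq_integral_Ioc, ← intervalIntegral.integral_of_le hpi]
  split_ifs with h
  · subst h
    simp
    ring
  · have hc : (-Complex.I * n) ≠ 0 := by simp [h]
    have : ∀ t : ℝ, Complex.exp (-Complex.I * ((n : ℝ) * t : ℝ))
        = Complex.exp ((-Complex.I * n) * t) := by
      intro t; congr 1; push_cast; ring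
    simp_rw [this]
    rw [integral_exp_mul_complex hc, div_eq_zero_iff]
    left
    rw [sub_eq_zero, Complex.exp_eq_exp_iff_exists_int]
    refine ⟨-n, ?_⟩
    push_cast; ring

lemma int_ech {d : ℕ} (x : Fin d → ℤ) :
    ∫ ξ, ech x ξ ∂(cubeMeas d) = if x = 0 then (((2 * π) ^ d : ℝ) : ℂ) else 0 := by
  have h1 : cubeMeas d = Measure.pi (fun _ : Fin d => volume.restrict (Set.Icc (-π) π)) := by
    unfold cubeMeas
    rw [volume_pi, Measure.restrict_pi_pi]
  have h2 : ∀ ξ : Fin d → ℝ, ech x ξ = ∏ j, Complex.exp (-Complex.I * ((x j : ℝ) * ξ j : ℝ)) := by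
    intro ξ
    unfold ech
    rw [← Complex.exp_sum, ← Finset.mul_sum, Complex.ofReal_sum]
  simp_rw [h2, h1]
  rw [integral_fintype_prod_eq_prod (𝕜 := ℂ)
    (fun (j : Fin d) (t : ℝ) => Complex.exp (-Complex.I * ((x j : ℝ) * t : ℝ)))]
  simp_rw [int_one]
  split_ifs with h
  · subst h; simp
  · obtain ⟨j, hj⟩ := Function.ne_iff.mp h
    exact Finset.prod_eq_zero (Finset.mem_univ j) (if_neg hj)

lemma ginv_cont (d : ℕ) {E : ℝ} (hE : E < 0) :
    Continuous (fun ξ : Fin d → ℝ => (((gsym d E ξ)⁻¹ : ℝ) : ℂ)) :=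
  Complex.continuous_ofReal.comp ((gsym_cont d E).inv₀ fun ξ => (gsym_pos d hE ξ).ne')

lemma Ucx_eq (d : ℕ) {E : ℝ} (hE : E < 0) (x : Fin d → ℤ) :
    -(∑ j : Fin d, ((Ucx d E (x + Pi.single j 1) - Ucx d E x)
      + (Ucx d E (x - Pi.single j 1) - Ucx d E x))) + (|E| : ℝ) * Ucx d E x
      = ∫ ξ, ech x ξ ∂(cubeMeas d) := by
  have hi : ∀ y : Fin d → ℤ,
      Integrable (fun ξ => (((gsym d E ξ)⁻¹ : ℝ) : ℂ) * ech y ξ) (cubeMeas d) :=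
    fun y => cont_int ((ginv_cont d hE).mul (ech_cont y))
  unfold Ucx
  simp_rw [← integral_sub (hi _) (hi _)]
  have h3 : ∀ j : Fin d, _ := fun j => integral_add ((hi (x + Pi.single j 1)).sub (hi x))
    ((hi (x - Pi.single j 1)).sub (hi x))
  simp only [Pi.sub_apply] at h3
  simp_rw [← h3]
  have hj : ∀ j ∈ (Finset.univ : Finset (Fin d)), Integrable (fun ξ =>
      ((((gsym d E ξ)⁻¹ : ℝ) : ℂ) * ech (x + Pi.single j 1) ξ
        - (((gsym d E ξ)⁻¹ : ℝ) : ℂ) * ech x ξ) + ((((gsym d E ξ)⁻¹ : ℝ) : ℂ) *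
        ech (x - Pi.single j 1) ξ - (((gsym d E ξ)⁻¹ : ℝ) : ℂ) * ech x ξ)) (cubeMeas d) :=
    fun j _ => ((hi (x + Pi.single j 1)).sub (hi x)).add ((hi (x - Pi.single j 1)).sub (hi x))
  rw [← integral_finsetSum _ hj,
    ← integral_neg, ← integral_const_mul, ← integral_add]
  · congr 1
    ext ξ
    have h4 : ∀ j : Fin d, ((((gsym d E ξ)⁻¹ : ℝ) : ℂ) * ech (x + Pi.single j 1) ξ
        - (((gsym d E ξ)⁻¹ : ℝ) : ℂ) * ech x ξ) + ((((gsym d E ξ)⁻¹ : ℝ) : ℂ) *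
        ech (x - Pi.single j 1) ξ - (((gsym d E ξ)⁻¹ : ℝ) : ℂ) * ech x ξ)
        = -((((gsym d E ξ)⁻¹ : ℝ) : ℂ) * ech x ξ) * ((4 * Real.sin (ξ j / 2) ^ 2 : ℝ) : ℂ) := by
      intro j
      linear_combination (((gsym d E ξ)⁻¹ : ℝ) : ℂ) * ech_lap x j ξ
    simp_rw [h4]
    rw [← Finset.mul_sum, ← Complex.ofReal_sum, ← Finset.mul_sum]
    have h5 : (((gsym d E ξ)⁻¹ : ℝ) : ℂ) * ((4 * ∑ j, Real.sin (ξ j / 2) ^ 2 + |E| : ℝ) : ℂ) = 1 := by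
      rw [← Complex.ofReal_mul]
      have := inv_mul_cancel₀ (gsym_pos d hE ξ).ne'
      exact_mod_cast this
    rw [Complex.ofReal_add] at h5
    linear_combination ech x ξ * h5
  · exact (integrable_finsetSum _ hj).neg
  · exact (hi x).const_mul _

lemma ufun_fund (d : ℕ) {E : ℝ} (hE : E < 0) (x : Fin d → ℤ) :
    H0 (ufun d E) x + |E| * ufun d E x = (if x = 0 then (1:ℝ) else 0) := by
  have h := congrArg Complex.re ((Ucx_eq d hE x).trans (int_ech x))
  rw [Complex.add_re, Complex.neg_re, Complex.re_sum, Complex.re_ofReal_mul] at h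
  simp only [Complex.add_re, Complex.sub_re] at h
  unfold H0
  simp only [ufun_eq, ← mul_sub, ← mul_add]
  rw [← Finset.mul_sum]
  have hp : ((2 * π) ^ d : ℝ) ≠ 0 := by positivity
  calc _ = ((2 * π) ^ d)⁻¹ * (if x = 0 then (((2 * π) ^ d : ℝ) : ℂ) else 0).re := by
        rw [← h]; ring
    _ = _ := by
        split_ifs
        · rw [Complex.ofReal_re, inv_mul_cancel₀ hp]
        · simp

lemma ufun_pos (d : ℕ) {E : ℝ} (hE : E < 0) : 0 < ufun d E 0 := by
  rw [ufun_eq]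
  have h : Ucx d E 0 = ((∫ ξ, (gsym d E ξ)⁻¹ ∂(cubeMeas d) : ℝ) : ℂ) := by
    unfold Ucx
    simp_rw [ech_zero, mul_one]
    exact integral_ofReal
  rw [h, Complex.ofReal_re]
  refine mul_pos (by positivity) ?_
  have hi : Integrable (fun ξ => (gsym d E ξ)⁻¹) (cubeMeas d) := by
    have := (cont_int (ginv_cont d hE)).re
    simpa using this
  rw [integral_pos_iff_support_of_nonneg (fun ξ => (inv_pos.mpr (gsym_pos d hE ξ)).le) hi]
  have hs : Function.support (fun ξ => (gsym d E ξ)⁻¹) = Set.univ := by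
    ext ξ; simp [(gsym_pos d hE ξ).ne']
  rw [hs, cubeMeas, Measure.restrict_apply_univ, volume_pi, Measure.pi_pi]
  rw [pos_iff_ne_zero, Finset.prod_ne_zero_iff]
  intro j _
  rw [Real.volume_Icc, ← pos_iff_ne_zero, ENNReal.ofReal_pos]
  linarith [Real.pi_pos]

lemma cont_memLp {d : ℕ} {f : (Fin d → ℝ) → ℂ} (hf : Continuous f) :
    MemLp f 2 (cubeMeas d) := by
  have hK : IsCompact (Set.univ.pi (fun _ : Fin d => Set.Icc (-π) π)) :=
    isCompact_univ_pi fun _ => isCompact_Icc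
  obtain ⟨C, hC⟩ := hK.exists_bound_of_continuousOn hf.continuousOn
  refine MemLp.of_bound hf.aestronglyMeasurable C ?_
  exact (ae_restrict_iff' hK.measurableSet).mpr (Filter.Eventually.of_forall hC)

lemma ufun_mem (d : ℕ) {E : ℝ} (hE : E < 0) : Memℓp (ufun d E) 2 := by
  set r : ℝ := (Real.sqrt ((2 * π) ^ d))⁻¹ with hr
  have hP : (0:ℝ) < (2 * π) ^ d := by positivity
  have hr0 : 0 < r := by positivity
  have hr2 : r * r * (2 * π) ^ d = 1 := by
    rw [hr, ← mul_inv, Real.mul_self_sqrt hP.le, inv_mul_cancel₀ hP.ne']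
  have hc : ∀ x : Fin d → ℤ, Continuous (fun ξ => (r : ℂ) * ech (-x) ξ) :=
    fun x => continuous_const.mul (ech_cont _)
  let v : (Fin d → ℤ) → Lp ℂ 2 (cubeMeas d) := fun x => (cont_memLp (hc x)).toLp _
  let g : Lp ℂ 2 (cubeMeas d) := (cont_memLp (ginv_cont d hE)).toLp _
  have hv : Orthonormal ℂ v := by
    classical
    rw [orthonormal_iff_ite]
    intro x y
    have h1 : inner ℂ (v x) (v y) = ∫ ξ, ((r * r : ℝ) : ℂ) * ech (x - y) ξ ∂(cubeMeas d) := by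
      rw [L2.inner_def]
      refine integral_congr_ae ?_
      filter_upwards [(cont_memLp (hc x)).coeFn_toLp, (cont_memLp (hc y)).coeFn_toLp] with ξ h1 h2
      simp only [v]
      rw [h1, h2, RCLike.inner_apply, map_mul, ← ech_neg, neg_neg, sub_eq_add_neg, ech_add,
        Complex.conj_ofReal]
      push_cast; ring
    rw [h1, integral_const_mul, int_ech]
    simp only [sub_eq_zero]
    split_ifs
    · exact_mod_cast hr2
    · simp
  have hin : ∀ x, inner ℂ (v x) g = (r : ℂ) * Ucx d E x := by
    intro x
    unfold Ucx
    rw [← integral_const_mul, L2.inner_def]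
    refine integral_congr_ae ?_
    filter_upwards [(cont_memLp (hc x)).coeFn_toLp, (cont_memLp (ginv_cont d hE)).coeFn_toLp]
      with ξ h1 h2
    simp only [v, g]
    rw [h1, h2, RCLike.inner_apply, map_mul, ← ech_neg, neg_neg, Complex.conj_ofReal]
    ring
  have hs := hv.inner_products_summable g
  have hs2 := hs.mul_left ((r ^ 2)⁻¹ * (((2 * π) ^ d)⁻¹) ^ 2)
  refine memℓp_gen ?_
  simp only [ENNReal.toReal_ofNat, Real.rpow_two]
  refine Summable.of_nonneg_of_le (fun x => by positivity) (fun x => ?_) hs2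
  rw [hin, ufun_eq, norm_mul, norm_mul, Complex.norm_real, Real.norm_of_nonneg hr0.le,
    Real.norm_of_nonneg (inv_pos.mpr hP).le]
  have : ‖(Ucx d E x).re‖ ≤ ‖Ucx d E x‖ := Complex.abs_re_le_norm _
  calc _ ≤ (((2 * π) ^ d)⁻¹ * ‖Ucx d E x‖) ^ 2 := by gcongr
    _ = _ := by field_simp

/-- for `E < 0`, the function `u` satisfies (i) `u ∈ ℓ²(ℤ^d)`;
(ii) `(H₀ + |E|)u = δ₀`; (iii) `u(0) > 0`; (iv) with `V = −u(0)^{−1} δ₀`,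
`(H₀ + V)u = Eu`, i.e. `u` is an `ℓ²` eigenfunction with eigenvalue `E`. -/
theorem ufun_eigenfunction (d : ℕ) (hd : 0 < d) (E : ℝ) (hE : E < 0) :
    Memℓp (ufun d E) 2 ∧
    (∀ x : Fin d → ℤ, H0 (ufun d E) x + |E| * ufun d E x =
      (if x = 0 then (1:ℝ) else 0)) ∧
    0 < ufun d E 0 ∧
    (∀ x : Fin d → ℤ, H0 (ufun d E) x +
      (-(ufun d E 0)⁻¹ * (if x = 0 then (1:ℝ) else 0)) * ufun d E x =
        E * ufun d E x) := by
  have h2 := ufun_fund d hE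
  have h3 := ufun_pos d hE
  refine ⟨ufun_mem d hE, h2, h3, fun x => ?_⟩
  have h := h2 x
  rw [abs_of_neg hE] at h
  by_cases hx : x = 0
  · subst hx
    simp only [if_true] at h ⊢
    have h5 := inv_mul_cancel₀ h3.ne'
    linear_combination h - h5
  · simp only [hx, if_false] at h ⊢
    linear_combination h

end
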